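/- arXiv:2309.13017 — 6 statements merged into one kernel-verified Lean document; each statement's English description precedes it below -/
import Mathlib

section
/- Let k be a field, R = k[x_1,…,x_m] with m ≥ 2, and let s ≥ 2 be an integer. Define L = { x_1^{a_1}⋯x_m^{a_m} : there exists 1 ≤ i ≤ m with Σ_{j ≠ i} a_j = s and a_i = max_{j ≠ i} a_j }. Then L is exactly the minimal monomial generating set of the symbolic power I(K_m)^{(s)} = ⋂_{i=1}^m P_i^s (where P_i = ⟨x_j : j ≠ i⟩); that is, L generates I(K_m)^{(s)} and no element of L is divisible by a different element of L. -/
open MvPolynomial Finset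

/-- The `n`-th power of an ideal generated by variables is spanned by the monomials whose degree in
those variables is at least `n`. -/
theorem MvPolynomial.span_X_image_pow {σ R : Type*} [Fintype σ] [CommSemiring R] (S : Finset σ)
    (n : ℕ) :
    Ideal.span ((X : σ → MvPolynomial σ R) '' S) ^ n =
      Ideal.span ((fun a : σ →₀ ℕ => monomial a (1 : R)) '' {a | n ≤ ∑ j ∈ S, a j}) := by
  classical
  apply le_antisymm
  · induction n with
    | zero =>
      have h : (1 : MvPolynomial σ R) ∈ Ideal.span
          ((fun a : σ →₀ ℕ => monomial a (1 : R)) '' {a | 0 ≤ ∑ j ∈ S, a j}) :=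
        Ideal.subset_span ⟨0, by simp, by simp⟩
      rw [(Ideal.eq_top_iff_one _).2 h]
      exact le_top
    | succ n ih =>
      rw [pow_succ]
      refine (Ideal.mul_mono_left ih).trans ?_
      rw [Ideal.span_mul_span', Ideal.span_le]
      rintro _ ⟨_, ⟨a, ha, rfl⟩, _, ⟨j, hj, rfl⟩, rfl⟩
      refine Ideal.subset_span ⟨a + Finsupp.single j 1, ?_, ?_⟩
      · have hj' : j ∈ S := hj
        have ha' : n ≤ ∑ j ∈ S, a j := ha
        simp [Finset.sum_add_distrib, Finsupp.single_apply, hj', ha']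
      · simp [X, monomial_mul]
  · rw [Ideal.span_le]
    rintro _ ⟨a, ha, rfl⟩
    have hprod : monomial a (1 : R) = (∏ j ∈ S, X j ^ a j) * ∏ j ∈ Sᶜ, X j ^ a j := by
      rw [Finset.prod_mul_prod_compl, monomial_eq, Finsupp.prod_fintype _ _ (by simp)]
      simp
    have hmem : (∏ j ∈ S, (X j : MvPolynomial σ R) ^ a j) ∈
        ∏ j ∈ S, Ideal.span ((X : σ → MvPolynomial σ R) '' S) ^ a j :=
      Ideal.prod_mem_prod fun j hj =>
        Ideal.pow_mem_pow (Ideal.subset_span (Set.mem_image_of_mem X hj)) _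
    rw [Finset.prod_pow_eq_pow_sum] at hmem
    change monomial a (1 : R) ∈ _
    rw [hprod]
    exact Ideal.mul_mem_right _ _ (Ideal.pow_le_pow_right ha hmem)

theorem Finset.exists_le_sum_eq {σ : Type*} (S : Finset σ) (f : σ → ℕ) {n : ℕ}
    (hn : n ≤ ∑ j ∈ S, f j) : ∃ g : σ → ℕ, g ≤ f ∧ ∑ j ∈ S, g j = n := by
  classical
  induction n with
  | zero => exact ⟨0, fun _ => Nat.zero_le _, by simp⟩
  | succ n ih =>
    obtain ⟨g, hgf, hg⟩ := ih (by omega)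
    obtain ⟨j, hj, hlt⟩ : ∃ j ∈ S, g j < f j := Finset.exists_lt_of_sum_lt (by omega)
    refine ⟨g + Pi.single j 1, fun i => ?_, by simp [Finset.sum_add_distrib, hg, hj]⟩
    by_cases h : i = j
    · subst h
      simpa using hlt
    · simpa [h] using hgf i

section

variable {σ : Type*} [Fintype σ] [DecidableEq σ] {s : ℕ} {a b : σ → ℕ} {i : σ}

theorem Finset.le_of_eq_sup_erase (ha : a i = (univ.erase i).sup a) (j : σ) : a j ≤ a i := by
  by_cases h : j = i
  · rw [h]
  · rw [ha]
    exact Finset.le_sup (by simpa using h)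

theorem Finset.le_sum_erase_of_eq_sup_erase (hs : ∑ j ∈ univ.erase i, a j = s)
    (ha : a i = (univ.erase i).sup a) (l : σ) : s ≤ ∑ j ∈ univ.erase l, a j := by
  have h₁ := Finset.add_sum_erase univ a (mem_univ i)
  have h₂ := Finset.add_sum_erase univ a (mem_univ l)
  have h₃ := le_of_eq_sup_erase ha l
  omega

theorem Finset.exists_le_sum_erase_eq [Nonempty σ] (h : ∀ i, s ≤ ∑ j ∈ univ.erase i, b j) :
    ∃ a ≤ b, ∃ i, ∑ j ∈ univ.erase i, a j = s ∧ a i = (univ.erase i).sup a := by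
  obtain ⟨i, hi⟩ := Finite.exists_max b
  obtain ⟨g, hgb, hg⟩ := Finset.exists_le_sum_eq _ _ (h i)
  have heq : ∀ j ∈ univ.erase i, Function.update g i ((univ.erase i).sup g) j = g j :=
    fun j hj => Function.update_of_ne (Finset.ne_of_mem_erase hj) _ _
  refine ⟨Function.update g i ((univ.erase i).sup g), ?_, i, ?_, ?_⟩
  · rw [update_le_iff]
    exact ⟨Finset.sup_le fun j _ => (hgb j).trans (hi j), fun j _ => hgb j⟩
  · rw [Finset.sum_congr rfl heq, hg]
  · rw [Finset.sup_congr rfl heq, Function.update_self]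

theorem Finset.eq_of_le_of_sum_erase_eq {l : σ} (hab : a ≤ b)
    (hsa : ∑ j ∈ univ.erase i, a j = s) (ha : a i = (univ.erase i).sup a)
    (hsb : ∑ j ∈ univ.erase l, b j = s) (hb : b l = (univ.erase l).sup b) : a = b := by
  have hsum : ∑ j ∈ univ.erase l, a j = ∑ j ∈ univ.erase l, b j :=
    le_antisymm (Finset.sum_le_sum fun j _ => hab j)
      (hsb.trans_le (le_sum_erase_of_eq_sup_erase hsa ha l))
  have heq := (Finset.sum_eq_sum_iff_of_le fun j _ => hab j).1 hsum
  have hil : a i = a l := by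
    have h₁ := Finset.add_sum_erase univ a (mem_univ i)
    have h₂ := Finset.add_sum_erase univ a (mem_univ l)
    omega
  funext j
  by_cases h : j = l
  · subst h
    refine le_antisymm (hab j) ?_
    rw [hb, ← Finset.sup_congr rfl heq, ← hil]
    exact Finset.sup_le fun t _ => le_of_eq_sup_erase ha t
  · exact heq j (by simpa using h)

end


open MvPolynomial Finset

/-- For a field `k`, `R = k[x_1,…,x_m]` with `m ≥ 2` and `s ≥ 2`, the set
`L = { x_1^{a_1}⋯x_m^{a_m} : ∃ i, ∑_{j ≠ i} a_j = s and a_i = max_{j ≠ i} a_j }` is exactly the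
minimal monomial generating set of `I(K_m)^{(s)} = ⋂_i P_i^s` (`P_i = ⟨x_j : j ≠ i⟩`): it
generates `I(K_m)^{(s)}`, and no element of `L` is divisible by a different element of `L`. -/
theorem minimal_generating_set_symbolicPower_completeGraph {k : Type*} [Field k] {m : ℕ}
    (hm : 2 ≤ m) (s : ℕ) (hs : 2 ≤ s) :
    Ideal.span {p : MvPolynomial (Fin m) k | ∃ a : Fin m →₀ ℕ,
        (∃ i : Fin m, (∑ j ∈ Finset.univ.erase i, a j) = s ∧
          a i = (Finset.univ.erase i).sup a) ∧ p = MvPolynomial.monomial a 1} =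
      (⨅ i : Fin m,
        (Ideal.span {p : MvPolynomial (Fin m) k | ∃ j : Fin m, j ≠ i ∧ p = X j}) ^ s) ∧
    ∀ a b : Fin m →₀ ℕ,
      (∃ i : Fin m, (∑ j ∈ Finset.univ.erase i, a j) = s ∧ a i = (Finset.univ.erase i).sup a) →
      (∃ i : Fin m, (∑ j ∈ Finset.univ.erase i, b j) = s ∧ b i = (Finset.univ.erase i).sup b) →
      a ≤ b → a = b := by
  have : Nonempty (Fin m) := ⟨⟨0, by omega⟩⟩
  constructor
  · have hL : {p : MvPolynomial (Fin m) k | ∃ a : Fin m →₀ ℕ,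
        (∃ i : Fin m, (∑ j ∈ Finset.univ.erase i, a j) = s ∧
          a i = (Finset.univ.erase i).sup a) ∧ p = MvPolynomial.monomial a 1} =
        (fun a : Fin m →₀ ℕ => monomial a (1 : k)) '' {a | ∃ i : Fin m,
          (∑ j ∈ Finset.univ.erase i, a j) = s ∧ a i = (Finset.univ.erase i).sup a} := by
      ext p
      simp only [Set.mem_ofPred_eq, Set.mem_image, eq_comm]
    have hP (i : Fin m) : {p : MvPolynomial (Fin m) k | ∃ j : Fin m, j ≠ i ∧ p = X j} =
        X '' (univ.erase i : Finset (Fin m)) := by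
      ext p
      simp [eq_comm]
    ext p
    simp only [hL, hP, span_X_image_pow, Ideal.mem_iInf, mem_ideal_span_monomial_image]
    constructor
    · intro h l b hb
      obtain ⟨a, ⟨i, hsum, ha⟩, hab⟩ := h b hb
      exact ⟨b, (le_sum_erase_of_eq_sup_erase hsum ha l).trans
        (Finset.sum_le_sum fun j _ => hab j), le_rfl⟩
    · intro h b hb
      have hle : ∀ l, s ≤ ∑ j ∈ univ.erase l, b j := fun l => by
        obtain ⟨a, ha, hab⟩ := h l b hb
        exact le_trans ha (Finset.sum_le_sum fun j _ => hab j)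
      obtain ⟨a, hab, ha⟩ := exists_le_sum_erase_eq hle
      exact ⟨Finsupp.equivFunOnFinite.symm a, ha, hab⟩
  · rintro a b ⟨i, hsa, ha⟩ ⟨l, hsb, hb⟩ hab
    exact DFunLike.coe_injective (eq_of_le_of_sum_erase_eq hab hsa ha hsb hb)
end

section
/- Let s ≥ 2 and m ≥ 2 be integers, and let L = { x_1^{a_1}⋯x_m^{a_m} : there exists 1 ≤ i ≤ m with Σ_{j ≠ i} a_j = s and a_i = max_{j ≠ i} a_j }. If x = x_1^{a_1}⋯x_m^{a_m} and y = x_1^{b_1}⋯x_m^{b_m} both belong to L and x divides y (i.e. a_t ≤ b_t for all t), then x = y. In other words, L is an antichain under divisibility of monomials. -/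
open Finset

/-- Let `s ≥ 2`, `m ≥ 2`, and let `L` be the set of exponent vectors
`(a_1,…,a_m)` for which some index `i` satisfies `∑_{j ≠ i} a_j = s` and
`a_i = max_{j ≠ i} a_j`.  If `a, b ∈ L` and the monomial of `a` divides that of `b`
(i.e. `a_t ≤ b_t` for all `t`), then `a = b`: `L` is an antichain under divisibility. -/
theorem antichain_of_exponent_condition {m s : ℕ} (hm : 2 ≤ m) (hs : 2 ≤ s)
    (a b : Fin m → ℕ)
    (ha : ∃ i : Fin m, (∑ j ∈ Finset.univ.erase i, a j) = s ∧
      a i = (Finset.univ.erase i).sup a)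
    (hb : ∃ i : Fin m, (∑ j ∈ Finset.univ.erase i, b j) = s ∧
      b i = (Finset.univ.erase i).sup b)
    (hdvd : ∀ t : Fin m, a t ≤ b t) : a = b := by
  obtain ⟨i, has, hai⟩ := ha
  obtain ⟨k, hbs, hbk⟩ := hb
  have ha_max : ∀ t, a t ≤ a i := by
    intro t
    by_cases h : t = i
    · rw [h]
    · rw [hai]
      exact Finset.le_sup (by simp [h])
  have hne : (Finset.univ.erase k).Nonempty := by
    rw [← Finset.card_pos, Finset.card_erase_of_mem (Finset.mem_univ k), Finset.card_univ,
      Fintype.card_fin]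
    omega
  obtain ⟨l, hl, hbl⟩ := Finset.exists_mem_eq_sup _ hne b
  have sum_a := Finset.add_sum_erase Finset.univ a (Finset.mem_univ i)
  have sum_a' := Finset.add_sum_erase Finset.univ a (Finset.mem_univ k)
  have sum_b := Finset.add_sum_erase Finset.univ b (Finset.mem_univ k)
  have sum_a_erase := Finset.add_sum_erase _ a hl
  have sum_b_erase := Finset.add_sum_erase _ b hl
  have rest_le : ∑ j ∈ (Finset.univ.erase k).erase l, a j ≤
      ∑ j ∈ (Finset.univ.erase k).erase l, b j :=
    Finset.sum_le_sum fun j _ => hdvd j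
  have hsum : ∑ j, a j = ∑ j, b j := by
    have := ha_max k
    have := ha_max l
    have := hdvd k
    have := hdvd l
    omega
  have heq := (Finset.sum_eq_sum_iff_of_le fun j _ => hdvd j).1 hsum
  exact funext fun t => heq t (Finset.mem_univ t)
end

section
/- Let k be a field, R = k[x_1,…,x_m] with m ≥ 2, and let s ≥ 2. Every element of the minimal monomial generating set of I(K_m)^{(s)} = ⋂_{i=1}^m P_i^s (where P_i = ⟨x_j : j ≠ i⟩) has total degree at least s+1 and at most 2s. -/
open MvPolynomial Finset

/-- A monomial (given by its exponent vector `a`) is a minimal monomial generator of a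
monomial ideal `I` iff it lies in `I` and is minimal under divisibility among monomials
of `I`.  (The minimal monomial generating set of a monomial ideal consists exactly of
the monomials of `I` minimal under divisibility.) -/
def IsMinimalMonomialGenerator {k : Type*} [Field k] {σ : Type*}
    (I : Ideal (MvPolynomial σ k)) (a : σ →₀ ℕ) : Prop :=
  MvPolynomial.monomial a (1 : k) ∈ I ∧
    ∀ b : σ →₀ ℕ, MvPolynomial.monomial b (1 : k) ∈ I → b ≤ a → b = a

/-- A monomial lies in the `s`-th power of the ideal generated by the variables other than `x_i`
iff its degree in these variables is at least `s`. -/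
theorem monomial_mem_span_X_ne_pow_iff {k : Type*} [Field k] {σ : Type*} [Fintype σ]
    [DecidableEq σ] (i : σ) (s : ℕ) (a : σ →₀ ℕ) :
    monomial a (1 : k) ∈
        (Ideal.span {p : MvPolynomial σ k | ∃ j : σ, j ≠ i ∧ p = X j}) ^ s ↔
      s ≤ ∑ j ∈ univ.erase i, a j := by
  have hmon : monomial a (1 : k) = ∏ j : σ, (X j : MvPolynomial σ k) ^ a j := by
    rw [monomial_eq, C_1, one_mul, Finsupp.prod_fintype _ _ fun _ => pow_zero _]
  rw [hmon, ← Finset.mul_prod_erase univ _ (mem_univ i)]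
  constructor
  · intro h
    let φ : MvPolynomial σ k →ₐ[k] Polynomial k :=
      aeval fun j => if j = i then 1 else Polynomial.X
    have hle : (Ideal.span {p : MvPolynomial σ k | ∃ j : σ, j ≠ i ∧ p = X j}).map φ ≤
        Ideal.span {Polynomial.X} := by
      rw [Ideal.map_span, Ideal.span_le]
      rintro _ ⟨_, ⟨j, hj, rfl⟩, rfl⟩
      simp [φ, hj]
    have hmem := Ideal.mem_map_of_mem φ h
    rw [Ideal.map_pow] at hmem
    have hdvd := Ideal.pow_right_mono hle s hmem
    rw [Ideal.span_singleton_pow, Ideal.mem_span_singleton] at hdvd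
    have himg : φ (X i ^ a i * ∏ j ∈ univ.erase i, X j ^ a j) =
        Polynomial.X ^ ∑ j ∈ univ.erase i, a j := by
      rw [map_mul, map_pow, map_prod, ← Finset.prod_pow_eq_pow_sum]
      have hi : φ (X i) = 1 := by simp [φ]
      rw [hi, one_pow, one_mul]
      refine Finset.prod_congr rfl fun j hj => ?_
      simp [φ, Finset.ne_of_mem_erase hj]
    rw [himg] at hdvd
    exact (pow_dvd_pow_iff Polynomial.X_ne_zero Polynomial.not_isUnit_X).mp hdvd
  · intro h
    refine Ideal.mul_mem_left _ _ (Ideal.pow_le_pow_right h ?_)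
    rw [← Finset.prod_pow_eq_pow_sum]
    exact Ideal.prod_mem_prod fun j hj => Ideal.pow_mem_pow
      (Ideal.subset_span (by exact ⟨j, Finset.ne_of_mem_erase hj, rfl⟩)) _

/-- For a field `k`, `R = k[x_1,…,x_m]` with `m ≥ 2` and `s ≥ 2`, every
element of the minimal monomial generating set of `I(K_m)^{(s)} = ⋂_i P_i^s`
(`P_i = ⟨x_j : j ≠ i⟩`) has total degree at least `s + 1` and at most `2s`. -/
theorem degree_bounds_minimal_generators_symbolicPower {k : Type*} [Field k] {m : ℕ}
    (hm : 2 ≤ m) (s : ℕ) (hs : 2 ≤ s) (a : Fin m →₀ ℕ)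
    (ha : IsMinimalMonomialGenerator
      (⨅ i : Fin m,
        (Ideal.span {p : MvPolynomial (Fin m) k | ∃ j : Fin m, j ≠ i ∧ p = X j}) ^ s) a) :
    s + 1 ≤ ∑ j : Fin m, a j ∧ ∑ j : Fin m, a j ≤ 2 * s := by
  have hsum (b : Fin m →₀ ℕ) (i : Fin m) : b i + ∑ j ∈ univ.erase i, b j = ∑ j, b j :=
    Finset.add_sum_erase univ b (mem_univ i)
  obtain ⟨hmem, hmin⟩ := ha
  simp only [Ideal.mem_iInf, monomial_mem_span_X_ne_pow_iff] at hmem hmin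
  have hpos : ∃ j, 0 < a j := by
    by_contra! h
    have h0 := hmem ⟨0, by omega⟩
    rw [Finset.sum_eq_zero fun j _ => Nat.le_zero.mp (h j)] at h0
    omega
  -- Lowering a positive exponent `a j` violates the condition at some `i ≠ j`.
  have htight (j : Fin m) (hj : 0 < a j) : ∃ i, i ≠ j ∧ a i + s = ∑ l, a l := by
    by_contra! h
    have hle : Finsupp.single j 1 ≤ a := Finsupp.single_le_iff.mpr hj
    have hadd : a - Finsupp.single j 1 + Finsupp.single j 1 = a := tsub_add_cancel_of_le hle
    have htotal : ∑ l, (a - Finsupp.single j 1 : Fin m →₀ ℕ) l + 1 = ∑ l, a l := by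
      conv_rhs => rw [← hadd]
      simp only [Finsupp.add_apply, Finset.sum_add_distrib]
      simp [Finsupp.single_apply]
    have heq := hmin (a - Finsupp.single j 1) (fun i => ?_) tsub_le_self
    · rw [heq] at htotal
      omega
    · have h1 := hsum a i
      have h2 := hsum (a - Finsupp.single j 1) i
      have h3 := hmem i
      by_cases hij : i = j
      · subst hij
        have h4 : (a - Finsupp.single i 1 : Fin m →₀ ℕ) i = a i - 1 := by simp
        omega
      · have h4 : (a - Finsupp.single j 1 : Fin m →₀ ℕ) i = a i := by simp [Ne.symm hij]
        have h5 := h i hij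
        omega
  obtain ⟨j, hj⟩ := hpos
  refine ⟨?_, ?_⟩
  · have h1 := hsum a j
    have h2 := hmem j
    omega
  · by_contra! hlt
    obtain ⟨i, -, hi⟩ := htight j hj
    obtain ⟨l, hli, hl⟩ := htight i (by omega)
    have h1 := hsum a i
    have h2 : a l ≤ ∑ j ∈ univ.erase i, a j :=
      Finset.single_le_sum (fun _ _ => Nat.zero_le _) (mem_erase.mpr ⟨hli, mem_univ l⟩)
    omega
end

section
/- Let k be a field, R = k[x_1,…,x_m] with m ≥ 3, and let s ≥ 2. Let I_{H,s} ⊆ R be the ideal generated by those elements of the minimal monomial generating set of I(K_m)^{(s)} that are not divisible by x_m (equivalently, the extension to R of the symbolic power I(K_{m−1})^{(s)} ⊆ k[x_1,…,x_{m−1}]), and let I_{G∖H,s} = I(K_m)^{(s)} ∩ ⟨x_m⟩. Then I_{H,s} ∩ I_{G∖H,s} = x_m · I_{H,s}. -/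
open MvPolynomial Finset

/-- If a monomial ideal is generated by monomials not involving the variable `i`, then its
intersection with `⟨X i⟩` is its product with `⟨X i⟩`. -/
theorem span_monomial_inf_span_X {R σ : Type*} [CommSemiring R] (i : σ) (S : Set (σ →₀ ℕ))
    (hS : ∀ a ∈ S, a i = 0) :
    Ideal.span ((fun a => MvPolynomial.monomial a (1 : R)) '' S) ⊓
        Ideal.span {(X i : MvPolynomial σ R)} =
      Ideal.span {(X i : MvPolynomial σ R)} *
        Ideal.span ((fun a => MvPolynomial.monomial a (1 : R)) '' S) := by
  classical
  refine le_antisymm ?_ (le_inf Ideal.mul_le_right Ideal.mul_le_left)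
  rintro f ⟨hf, hfX⟩
  obtain ⟨g, rfl⟩ := Ideal.mem_span_singleton.1 hfX
  refine Ideal.mem_span_singleton_mul.2 ⟨g, ?_, rfl⟩
  rw [mem_ideal_span_monomial_image]
  intro c hc
  have hc' : Finsupp.single i 1 + c ∈ (X i * g).support := by
    rw [mem_support_iff, coeff_X_mul]
    exact mem_support_iff.1 hc
  obtain ⟨a, ha, hac⟩ := mem_ideal_span_monomial_image.1 hf _ hc'
  refine ⟨a, ha, fun j => ?_⟩
  by_cases hj : j = i
  · rw [hj, hS a ha]
    exact Nat.zero_le _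
  · simpa [Finsupp.single_apply, Ne.symm hj] using hac j

/-- Let `k` be a field, `R = k[x_1,…,x_m]` with `m ≥ 3`, `s ≥ 2`.  With
`I = I(K_m)^{(s)} = ⋂_i P_i^s`, let `I_{H,s}` be the ideal generated by the minimal
monomial generators of `I` not divisible by `x_m`, and `I_{G∖H,s} = I ∩ ⟨x_m⟩`.  Then
`I_{H,s} ∩ I_{G∖H,s} = x_m · I_{H,s}`. -/
theorem inter_eq_xm_mul {k : Type*} [Field k] {m : ℕ} (hm : 3 ≤ m) (s : ℕ) (hs : 2 ≤ s)
    (i₀ : Fin m) (hi₀ : (i₀ : ℕ) = m - 1)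
    (I IH IGH : Ideal (MvPolynomial (Fin m) k))
    (hI : I = ⨅ i : Fin m,
      (Ideal.span {p : MvPolynomial (Fin m) k | ∃ j : Fin m, j ≠ i ∧ p = X j}) ^ s)
    (hIH : IH = Ideal.span {p : MvPolynomial (Fin m) k | ∃ a : Fin m →₀ ℕ,
      IsMinimalMonomialGenerator I a ∧ a i₀ = 0 ∧ p = MvPolynomial.monomial a 1})
    (hIGH : IGH = I ⊓ Ideal.span {(X i₀ : MvPolynomial (Fin m) k)}) :
    IH ⊓ IGH = Ideal.span {(X i₀ : MvPolynomial (Fin m) k)} * IH := by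
  have hle : IH ≤ I := by
    rw [hIH, Ideal.span_le]
    rintro _ ⟨a, ha, -, rfl⟩
    exact ha.1
  have hset : IH = Ideal.span ((fun a => MvPolynomial.monomial a (1 : k)) ''
      {a : Fin m →₀ ℕ | IsMinimalMonomialGenerator I a ∧ a i₀ = 0}) := by
    rw [hIH]
    congr 1
    ext p
    simp only [Set.mem_ofPred_eq, Set.mem_image, and_assoc, eq_comm]
  rw [hIGH, ← inf_assoc, inf_eq_left.2 hle, hset]
  exact span_monomial_inf_span_X i₀ _ fun _ ha => ha.2
end

section
/- Let k be a field, R = k[x_1,…,x_m] with m ≥ 3, and let s ≥ 2. Let I_{H,s} be the ideal generated by the minimal monomial generators of I(K_m)^{(s)} not divisible by x_m, and let I_{G∖H,s} = I(K_m)^{(s)} ∩ ⟨x_m⟩. Then I(K_m)^{(s)} = I_{H,s} + I_{G∖H,s} is an Eliahou–Kervaire splitting. -/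
open MvPolynomial Finset

/-- `I = J + K` is an Eliahou–Kervaire splitting: `I = J + K`, the minimal monomial
generating set of `I` is the disjoint union of those of `J` and `K`, and there is a
splitting function `w ↦ (φ w, ψ w)` from `𝒢(J ∩ K)` to `𝒢(J) × 𝒢(K)` with
`w = lcm(φ w, ψ w)`, such that for every nonempty (finite) subset `S ⊆ 𝒢(J ∩ K)` both
`lcm(φ(S))` and `lcm(ψ(S))` strictly divide `lcm(S)`.  (Monomials are identified with
their exponent vectors; lcm is the pointwise `⊔`, and strict divisibility is `<` in the
pointwise order.) -/
def IsEKSplitting {k : Type*} [Field k] {σ : Type*} [DecidableEq σ]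
    (I J K : Ideal (MvPolynomial σ k)) : Prop :=
  I = J ⊔ K ∧
  (∀ a : σ →₀ ℕ, IsMinimalMonomialGenerator I a ↔
    (IsMinimalMonomialGenerator J a ∨ IsMinimalMonomialGenerator K a)) ∧
  (∀ a : σ →₀ ℕ, ¬ (IsMinimalMonomialGenerator J a ∧ IsMinimalMonomialGenerator K a)) ∧
  ∃ φ ψ : (σ →₀ ℕ) → (σ →₀ ℕ),
    (∀ w : σ →₀ ℕ, IsMinimalMonomialGenerator (J ⊓ K) w →
      IsMinimalMonomialGenerator J (φ w) ∧ IsMinimalMonomialGenerator K (ψ w) ∧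
        w = φ w ⊔ ψ w) ∧
    (∀ S : Finset (σ →₀ ℕ), S.Nonempty →
      (∀ w ∈ S, IsMinimalMonomialGenerator (J ⊓ K) w) →
      (S.image φ).sup id < S.sup id ∧ (S.image ψ).sup id < S.sup id)

namespace MvPolynomial

variable {σ k : Type*}

theorem span_X_image_pow_eq_span_monomial [CommSemiring k] (t : Set σ)
    [DecidablePred (· ∈ t)] (n : ℕ) :
    (Ideal.span ((X : σ → MvPolynomial σ k) '' t)) ^ n =
      Ideal.span ((fun a => monomial a (1 : k)) '' {a | n ≤ (a.filter (· ∈ t)).degree}) := by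
  apply le_antisymm
  · induction n with
    | zero =>
      have h : (1 : MvPolynomial σ k) ∈ Ideal.span
          ((fun a => monomial a (1 : k)) '' {a | 0 ≤ (a.filter (· ∈ t)).degree}) :=
        Ideal.subset_span ⟨0, by simp, rfl⟩
      rw [(Ideal.eq_top_iff_one _).2 h]
      exact le_top
    | succ n ih =>
      rw [pow_succ]
      refine (Ideal.mul_mono_left ih).trans ?_
      rw [Ideal.span_mul_span', Ideal.span_le]
      rintro _ ⟨_, ⟨a, ha, rfl⟩, _, ⟨j, hj, rfl⟩, rfl⟩
      refine Ideal.subset_span ⟨a + Finsupp.single j 1, ?_, by simp [X, monomial_mul]⟩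
      simp only [Set.mem_ofPred_eq] at ha ⊢
      rw [Finsupp.filter_add, map_add, Finsupp.filter_single_of_pos _ hj, Finsupp.degree_single]
      lia
  · rw [Ideal.span_le]
    rintro _ ⟨a, ha, rfl⟩
    have key : ∀ b : σ →₀ ℕ, (∀ j ∈ b.support, j ∈ t) →
        monomial b (1 : k) ∈ (Ideal.span ((X : σ → MvPolynomial σ k) '' t)) ^ b.degree := by
      intro b hb
      rw [monomial_eq, C_1, one_mul, Finsupp.degree_apply, ← Finset.prod_pow_eq_pow_sum]
      exact Ideal.prod_mem_prod fun j hj =>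
        Ideal.pow_mem_pow (Ideal.subset_span (Set.mem_image_of_mem X (hb j hj))) _
    have h := Ideal.mul_mem_right (monomial (a.filter fun j => ¬ j ∈ t) (1 : k)) _
      (Ideal.pow_le_pow_right ha (key (a.filter (· ∈ t)) fun j hj => by
        simp only [Finsupp.support_filter, Finset.mem_filter] at hj
        exact hj.2))
    rwa [monomial_mul, Finsupp.filter_add_filter_not, one_mul] at h

theorem mem_span_X_image_pow_iff [CommSemiring k] (t : Set σ) [DecidablePred (· ∈ t)] (n : ℕ)
    (f : MvPolynomial σ k) :
    f ∈ (Ideal.span ((X : σ → MvPolynomial σ k) '' t)) ^ n ↔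
      ∀ a ∈ f.support, n ≤ (a.filter (· ∈ t)).degree := by
  rw [span_X_image_pow_eq_span_monomial, mem_ideal_span_monomial_image]
  refine forall₂_congr fun a _ => ⟨?_, fun h => ⟨a, h, le_rfl⟩⟩
  rintro ⟨b, hb, hba⟩
  refine le_trans hb (Finsupp.degree_mono fun j => ?_)
  by_cases hj : j ∈ t
  · simpa [hj] using hba j
  · simp [hj]

theorem monomial_one_mem_of_le [CommSemiring k] {I : Ideal (MvPolynomial σ k)} {a b : σ →₀ ℕ}
    (hab : a ≤ b) (ha : monomial a (1 : k) ∈ I) : monomial b (1 : k) ∈ I := by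
  have h := I.mul_mem_left (monomial (b - a) (1 : k)) ha
  rwa [monomial_mul, tsub_add_cancel_of_le hab, one_mul] at h

end MvPolynomial

theorem Finsupp.degree_filter_mem_compl_singleton_add {σ : Type*} (a : σ →₀ ℕ) (i : σ)
    [DecidablePred (· ∈ ({i}ᶜ : Set σ))] :
    (a.filter (· ∈ ({i}ᶜ : Set σ))).degree + a i = a.degree := by
  classical
  have h : a.filter (· ∈ ({i}ᶜ : Set σ)) = a.erase i := by
    ext j
    by_cases hj : j = i <;> simp [hj]
  rw [h]
  conv_rhs => rw [← Finsupp.erase_add_single i a, map_add, Finsupp.degree_single]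

/-- A polynomial lies in the `s`-th symbolic power of the edge ideal of the complete graph iff
every exponent vector `a` in its support satisfies `s ≤ |a| - a i` for all `i`. -/
theorem mem_symbolicPower_completeGraph_iff {σ k : Type*} [CommSemiring k] (s : ℕ)
    (f : MvPolynomial σ k) :
    f ∈ (⨅ i : σ, (Ideal.span {p : MvPolynomial σ k | ∃ j : σ, j ≠ i ∧ p = X j}) ^ s) ↔
      ∀ a ∈ f.support, ∀ i, s + a i ≤ a.degree := by
  classical
  have h : ∀ i : σ, {p : MvPolynomial σ k | ∃ j : σ, j ≠ i ∧ p = X j} =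
      (X : σ → MvPolynomial σ k) '' {i}ᶜ := by
    intro i
    ext p
    simp [eq_comm]
  simp only [h, Ideal.mem_iInf, mem_span_X_image_pow_iff]
  rw [forall_comm]
  refine forall_congr' fun a => ?_
  rw [forall_comm]
  refine forall₂_congr fun _ i => ?_
  rw [← Finsupp.degree_filter_mem_compl_singleton_add a i]
  lia

theorem exists_isMinimalMonomialGenerator_le {k σ : Type*} [Field k] [Finite σ]
    {I : Ideal (MvPolynomial σ k)} {a : σ →₀ ℕ} (ha : monomial a (1 : k) ∈ I) :
    ∃ b ≤ a, IsMinimalMonomialGenerator I b := by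
  obtain ⟨b, hba, hb⟩ := exists_minimal_le_of_wellFoundedLT
    (fun c : σ →₀ ℕ => monomial c (1 : k) ∈ I) a ha
  exact ⟨b, hba, hb.1, fun c hc hcb => hb.eq_of_le hc hcb⟩

theorem IsMinimalMonomialGenerator.of_le {k σ : Type*} [Field k]
    {I J : Ideal (MvPolynomial σ k)} {a : σ →₀ ℕ} (h : IsMinimalMonomialGenerator I a)
    (hJI : J ≤ I) (ha : monomial a (1 : k) ∈ J) : IsMinimalMonomialGenerator J a :=
  ⟨ha, fun b hb => h.2 b (hJI hb)⟩

theorem exists_first_argmax {m : ℕ} [NeZero m] (a : Fin m → ℕ) :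
    ∃ p, (∀ i, a i ≤ a p) ∧ ∀ i < p, a i < a p := by
  obtain ⟨q, hq⟩ := Finite.exists_max a
  obtain ⟨p, -, hp⟩ := exists_minimal_le_of_wellFoundedLT (fun p => ∀ i, a i ≤ a p) q hq
  refine ⟨p, hp.1, fun i hi => ?_⟩
  by_contra! h
  exact hi.ne (hp.eq_of_le (fun j => (hp.1 j).trans h) hi.le)

/-- Lowering, in every member of a finite family, the first coordinate at which the maximal
entry is attained strictly lowers the join of the family. -/
theorem exists_coord_sup_lt {m : ℕ} {S : Finset (Fin m →₀ ℕ)} (hS : S.Nonempty)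
    (f g : (Fin m →₀ ℕ) → Fin m → ℕ) (p : (Fin m →₀ ℕ) → Fin m)
    (hgf : ∀ w ∈ S, g w ≤ f w) (hmax : ∀ w ∈ S, ∀ i, f w i ≤ f w (p w))
    (hfirst : ∀ w ∈ S, ∀ i < p w, f w i < f w (p w))
    (hlt : ∀ w ∈ S, g w (p w) < f w (p w)) :
    ∃ v ∈ S, ∀ w ∈ S, g w (p v) < f v (p v) := by
  obtain ⟨v₀, hv₀, hv₀max⟩ := S.exists_max_image (fun w => f w (p w)) hS
  obtain ⟨v, hv, hvmin⟩ := (S.filter fun w => f w (p w) = f v₀ (p v₀)).exists_min_image p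
    ⟨v₀, by simp [hv₀]⟩
  simp only [Finset.mem_filter] at hv hvmin
  refine ⟨v, hv.1, fun w hw => ?_⟩
  by_contra! h
  have h₁ := hgf w hw (p v)
  have h₂ := hmax w hw (p v)
  have h₃ := hv₀max w hw
  have h₄ := hvmin w ⟨hw, by lia⟩
  obtain h₅ | h₅ := h₄.lt_or_eq
  · have := hfirst w hw _ h₅
    lia
  · have := hlt w hw
    rw [h₅] at h
    lia

theorem Finsupp.sup_id_image_lt {σ : Type*} [DecidableEq σ] {S : Finset (σ →₀ ℕ)}
    (f : (σ →₀ ℕ) → (σ →₀ ℕ)) (hf : ∀ w ∈ S, f w ≤ w) {v : σ →₀ ℕ} (hv : v ∈ S) (j : σ)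
    (hj : ∀ w ∈ S, f w j < v j) : (S.image f).sup id < S.sup id := by
  rw [Finset.sup_image]
  refine lt_of_le_of_ne (Finset.sup_mono_fun hf) fun h => ?_
  have h₁ : v j ≤ (S.sup id) j := Finset.le_sup (f := id) hv j
  have h₂ : (S.sup (id ∘ f)) j = S.sup fun w => f w j :=
    Finset.apply_sup_eq_sup_comp (fun a : σ →₀ ℕ => a j) (fun _ _ => rfl) rfl
  rw [← h, h₂] at h₁
  have h₃ : (S.sup fun w => f w j) < v j :=
    (Finset.sup_lt_iff (Nat.zero_lt_of_lt (hj v hv))).2 hj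
  lia

theorem symbolicPower_exponent_swap {σ : Type*} {s : ℕ} {d : σ →₀ ℕ} {i₀ p : σ}
    (h : ∀ i, s + (d + Finsupp.single p 1 : σ →₀ ℕ) i ≤ (d + Finsupp.single p 1 : σ →₀ ℕ).degree)
    (hp : p ≠ i₀) (hd : d i₀ = 0) :
    ∀ i, s + (d + Finsupp.single i₀ 1 : σ →₀ ℕ) i ≤
      (d + Finsupp.single i₀ 1 : σ →₀ ℕ).degree := by
  classical
  intro i
  have hi := h i
  have h_p := h p
  simp only [map_add, Finsupp.degree_single, Finsupp.add_apply, Finsupp.single_apply] at *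
  split_ifs at * <;> subst_vars <;> lia

/-- Let `k` be a field, `R = k[x_1,…,x_m]` with `m ≥ 3` and `s ≥ 2`.
With `I = I(K_m)^{(s)} = ⋂_i P_i^s`, let `I_{H,s}` be the ideal generated by the minimal
monomial generators of `I` not divisible by `x_m` and `I_{G∖H,s} = I ∩ ⟨x_m⟩`.  Then
`I = I_{H,s} + I_{G∖H,s}` is an Eliahou–Kervaire splitting. -/
theorem ek_splitting_symbolicPower_completeGraph {k : Type*} [Field k] {m : ℕ}
    (hm : 3 ≤ m) (s : ℕ) (hs : 2 ≤ s) (i₀ : Fin m) (hi₀ : (i₀ : ℕ) = m - 1)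
    (I IH IGH : Ideal (MvPolynomial (Fin m) k))
    (hI : I = ⨅ i : Fin m,
      (Ideal.span {p : MvPolynomial (Fin m) k | ∃ j : Fin m, j ≠ i ∧ p = X j}) ^ s)
    (hIH : IH = Ideal.span {p : MvPolynomial (Fin m) k | ∃ a : Fin m →₀ ℕ,
      IsMinimalMonomialGenerator I a ∧ a i₀ = 0 ∧ p = MvPolynomial.monomial a 1})
    (hIGH : IGH = I ⊓ Ideal.span {(X i₀ : MvPolynomial (Fin m) k)}) :
    IsEKSplitting I IH IGH := by
  classical
  have : NeZero m := ⟨by lia⟩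
  have memI : ∀ a : Fin m →₀ ℕ, monomial a (1 : k) ∈ I ↔ ∀ i, s + a i ≤ a.degree := by
    intro a
    rw [hI, mem_symbolicPower_completeGraph_iff]
    simp
  have memJ : ∀ a : Fin m →₀ ℕ, monomial a (1 : k) ∈ IH ↔
      ∃ b, (IsMinimalMonomialGenerator I b ∧ b i₀ = 0) ∧ b ≤ a := by
    intro a
    have : {p : MvPolynomial (Fin m) k | ∃ a : Fin m →₀ ℕ,
        IsMinimalMonomialGenerator I a ∧ a i₀ = 0 ∧ p = monomial a 1} =
        (fun a => monomial a (1 : k)) '' {a | IsMinimalMonomialGenerator I a ∧ a i₀ = 0} := by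
      ext p
      simp [and_assoc, eq_comm]
    rw [hIH, this, mem_ideal_span_monomial_image]
    simp
  have memK : ∀ a : Fin m →₀ ℕ, monomial a (1 : k) ∈ IGH ↔
      monomial a (1 : k) ∈ I ∧ a i₀ ≠ 0 := by
    intro a
    rw [hIGH, Ideal.mem_inf, Ideal.mem_span_singleton, X_dvd_monomial]
    simp
  have hJI : IH ≤ I := by
    rw [hIH, Ideal.span_le]
    rintro _ ⟨a, ha, -, rfl⟩
    exact ha.1
  have hKI : IGH ≤ I := hIGH ▸ inf_le_left
  have memJ_of_zero : ∀ a : Fin m →₀ ℕ, monomial a (1 : k) ∈ I → a i₀ = 0 →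
      monomial a (1 : k) ∈ IH := by
    intro a ha ha₀
    obtain ⟨b, hba, hb⟩ := exists_isMinimalMonomialGenerator_le ha
    exact (memJ a).2 ⟨b, ⟨hb, Nat.eq_zero_of_le_zero (ha₀ ▸ hba i₀)⟩, hba⟩
  have genJ : ∀ a : Fin m →₀ ℕ, IsMinimalMonomialGenerator IH a →
      IsMinimalMonomialGenerator I a ∧ a i₀ = 0 := by
    intro a ha
    obtain ⟨b, hb, hba⟩ := (memJ a).1 ha.1
    rwa [← ha.2 b ((memJ b).2 ⟨b, hb, le_rfl⟩) hba]
  have swap : ∀ (c : Fin m →₀ ℕ) (p : Fin m), monomial c (1 : k) ∈ I → c i₀ = 0 → c p ≠ 0 →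
      monomial (c - Finsupp.single p 1 + Finsupp.single i₀ 1) (1 : k) ∈ IGH := by
    intro c p hc hc₀ hcp
    refine (memK _).2 ⟨(memI _).2 (symbolicPower_exponent_swap (p := p) ?_ ?_ ?_), ?_⟩
    · rw [tsub_add_cancel_of_le (Finsupp.single_le_iff.2 (Nat.one_le_iff_ne_zero.2 hcp))]
      exact (memI c).1 hc
    · rintro rfl
      exact hcp hc₀
    · simp [hc₀]
    · simp
  have exists_pos : ∀ c : Fin m →₀ ℕ, monomial c (1 : k) ∈ I → ∃ p, c p ≠ 0 := by
    intro c hc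
    by_contra! h
    have h₁ := (memI c).1 hc i₀
    have h₂ : c = 0 := Finsupp.ext h
    simp only [h₂, map_zero] at h₁
    lia
  have genJK : ∀ w : Fin m →₀ ℕ, IsMinimalMonomialGenerator (IH ⊓ IGH) w →
      w i₀ = 1 ∧ IsMinimalMonomialGenerator IH (w.erase i₀) := by
    have key : ∀ c : Fin m →₀ ℕ, monomial c (1 : k) ∈ IH →
        monomial (c + Finsupp.single i₀ 1) (1 : k) ∈ IH ⊓ IGH := by
      intro c hc
      have h := monomial_one_mem_of_le (le_self_add : c ≤ c + Finsupp.single i₀ 1) hc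
      exact ⟨h, (memK _).2 ⟨hJI h, by simp⟩⟩
    intro w hw
    have hw₀ := ((memK w).1 hw.1.2).2
    have hsingle : Finsupp.single i₀ 1 ≤ Finsupp.single i₀ (w i₀) :=
      Finsupp.single_mono (Nat.one_le_iff_ne_zero.2 hw₀)
    have hle : ∀ c ≤ w.erase i₀, c + Finsupp.single i₀ 1 ≤ w := fun c hc =>
      (add_le_add hc hsingle).trans_eq (Finsupp.erase_add_single i₀ w)
    have hJ : monomial (w.erase i₀) (1 : k) ∈ IH := by
      obtain ⟨b, hb, hbw⟩ := (memJ w).1 hw.1.1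
      refine (memJ _).2 ⟨b, hb, fun j => ?_⟩
      by_cases hj : j = i₀
      · simp [hj, hb.2]
      · simpa [hj] using hbw j
    have hw' := hw.2 _ (key _ hJ) (hle _ le_rfl)
    refine ⟨by rw [← hw']; simp, hJ, fun c hc hcw => ?_⟩
    exact add_right_cancel ((hw.2 _ (key c hc) (hle c hcw)).trans hw'.symm)
  choose p hpmax hpfirst using fun w : Fin m →₀ ℕ => exists_first_argmax (w.erase i₀)
  have hψ : ∀ w : Fin m →₀ ℕ, ∃ c : Fin m →₀ ℕ, IsMinimalMonomialGenerator (IH ⊓ IGH) w →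
      IsMinimalMonomialGenerator IGH c ∧ w = w.erase i₀ ⊔ c ∧
        (p w ≠ i₀ ∧ c (p w) < w (p w)) ∧ c ≤ w := by
    intro w
    by_cases hw : IsMinimalMonomialGenerator (IH ⊓ IGH) w
    swap
    · exact ⟨0, fun h => absurd h hw⟩
    obtain ⟨hw₀, hwJ⟩ := genJK w hw
    have hpos : (w.erase i₀) (p w) ≠ 0 := by
      obtain ⟨q, hq⟩ := exists_pos _ (hJI hwJ.1)
      have := hpmax w q
      lia
    have hp₀ : p w ≠ i₀ := by
      intro h
      simp [h] at hpos
    obtain ⟨c, hcle, hc⟩ := exists_isMinimalMonomialGenerator_le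
      (swap _ (p w) (hJI hwJ.1) (by simp) hpos)
    have hc₀ := ((memK c).1 hc.1).2
    have hcw : c ≤ w := by
      intro j
      have := hcle j
      by_cases hj : j = i₀
      · subst hj
        simp at this
        lia
      · simp [hj, Finsupp.single_apply] at this
        lia
    refine ⟨c, fun _ => ⟨hc, ?_, ⟨hp₀, ?_⟩, hcw⟩⟩
    · ext j
      have := hcw j
      by_cases hj : j = i₀
      · subst hj
        simp
        lia
      · simpa [hj] using this
    · have := hcle (p w)
      simp [hp₀] at this hpos
      lia
  choose ψ hψ using hψ
  refine ⟨?_, fun a => ⟨fun ha => ?_, ?_⟩, fun a ⟨haJ, haK⟩ => ?_, fun w => w.erase i₀, ψ,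
    fun w hw => ⟨(genJK w hw).2, (hψ w hw).1, (hψ w hw).2.1⟩, fun S hS hSgen => ⟨?_, ?_⟩⟩
  · refine le_antisymm (fun f hf => ?_) (sup_le hJI hKI)
    rw [hI, mem_symbolicPower_completeGraph_iff] at hf
    rw [f.as_sum]
    refine Ideal.sum_mem _ fun a ha => ?_
    have haI := (memI a).2 (hf a ha)
    rw [← mul_one (coeff a f), ← C_mul_monomial]
    refine Ideal.mul_mem_left _ _ ?_
    by_cases ha₀ : a i₀ = 0
    · exact Ideal.mem_sup_left (memJ_of_zero a haI ha₀)
    · exact Ideal.mem_sup_right ((memK a).2 ⟨haI, ha₀⟩)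
  · by_cases ha₀ : a i₀ = 0
    · exact Or.inl (ha.of_le hJI (memJ_of_zero a ha.1 ha₀))
    · exact Or.inr (ha.of_le hKI ((memK a).2 ⟨ha.1, ha₀⟩))
  · rintro (ha | ha)
    · exact (genJ a ha).1
    · refine ⟨hKI ha.1, fun c hc hca => ?_⟩
      by_cases hc₀ : c i₀ = 0
      · obtain ⟨q, hq⟩ := exists_pos c hc
        have hq₀ : i₀ ≠ q := by
          rintro rfl
          exact hq hc₀
        have ha₀ := ((memK a).1 ha.1).2
        have heq := ha.2 _ (swap c q hc hc₀ hq) fun j => by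
          have := hca j
          by_cases hj : j = i₀
          · subst hj
            simp [hc₀]
            lia
          · simp [Finsupp.single_apply, Ne.symm hj]
            lia
        have h₁ := DFunLike.congr_fun heq q
        have h₂ := hca q
        simp [hq₀] at h₁
        lia
      · exact ha.2 c ((memK c).2 ⟨hc, hc₀⟩) hca
  · exact ((memK a).1 haK.1).2 (genJ a haJ).2
  · obtain ⟨v, hv⟩ := hS
    refine Finsupp.sup_id_image_lt _ (fun w _ j => ?_) hv i₀ fun w _ => ?_
    · by_cases hj : j = i₀ <;> simp [hj]
    · simp [(genJK v (hSgen v hv)).1]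
  · obtain ⟨v, hv, hlt⟩ := exists_coord_sup_lt hS (fun w => w.erase i₀)
      (fun w => (ψ w).erase i₀) p
      (fun w hw j => by
        have := (hψ w (hSgen w hw)).2.2.2 j
        by_cases hj : j = i₀ <;> simp [hj, this])
      (fun w _ => hpmax w) (fun w _ => hpfirst w)
      (fun w hw => by
        have := (hψ w (hSgen w hw)).2.2.1
        simpa [this.1] using this.2)
    have hp₀ := (hψ v (hSgen v hv)).2.2.1.1
    refine Finsupp.sup_id_image_lt ψ (fun w hw => (hψ w (hSgen w hw)).2.2.2) hv (p v)
      fun w hw => ?_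
    simpa [hp₀] using hlt w hw
end

section
/- Let k be a field and R = k[x_1,…,x_m]. If s ≥ m ≥ 2, then I(K_m)^{(s)} ∩ ⟨x_1 x_2 ⋯ x_m⟩ = x_1 x_2 ⋯ x_m · I(K_m)^{(s−m+1)}, where I(K_m)^{(t)} = ⋂_{i=1}^m P_i^t with P_i = ⟨x_j : j ≠ i⟩. -/
open MvPolynomial Finset

namespace MvPolynomial

variable {σ R : Type*} [CommSemiring R]

theorem monomial_mem_pow_span_X_image {T : Finset σ} {n : ℕ} {d : σ →₀ ℕ} (r : R)
    (hd : n ≤ ∑ j ∈ T, d j) :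
    monomial d r ∈ Ideal.span (X '' (T : Set σ) : Set (MvPolynomial σ R)) ^ n := by
  classical
  induction n generalizing d with
  | zero => simp
  | succ n ih =>
    obtain ⟨j, hjT, hj⟩ : ∃ j ∈ T, d j ≠ 0 := by
      by_contra! h
      rw [Finset.sum_eq_zero h] at hd
      omega
    obtain ⟨e, rfl⟩ : ∃ e, d = e + Finsupp.single j 1 :=
      le_iff_exists_add'.mp (by simpa [Nat.one_le_iff_ne_zero] using hj)
    have he : n ≤ ∑ i ∈ T, e i := by
      simpa [Finset.sum_add_distrib, Finsupp.single_apply, hjT] using hd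
    rw [monomial_add_single, pow_one, pow_succ]
    exact Ideal.mul_mem_mul (ih he) (Ideal.subset_span ⟨j, hjT, rfl⟩)

theorem mem_pow_span_X_image_iff {T : Finset σ} {n : ℕ} {p : MvPolynomial σ R} :
    p ∈ Ideal.span (X '' (T : Set σ) : Set (MvPolynomial σ R)) ^ n ↔
      ∀ d ∈ p.support, n ≤ ∑ j ∈ T, d j := by
  classical
  refine ⟨fun hp => ?_, fun hp => ?_⟩
  · induction n generalizing p with
    | zero => simp
    | succ n ih =>
      rw [pow_succ] at hp
      induction hp using Submodule.mul_induction_on' with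
      | mem_mul_mem a ha b hb =>
        intro d hd
        obtain ⟨d₁, h₁, d₂, h₂, rfl⟩ := Finset.mem_add.mp (support_mul a b hd)
        obtain ⟨j, hjT, hj⟩ := mem_ideal_span_X_image.mp hb d₂ h₂
        have hle := Finset.single_le_sum (f := d₂) (fun _ _ => Nat.zero_le _) hjT
        have := ih ha d₁ h₁
        simp only [Finsupp.add_apply, Finset.sum_add_distrib]
        omega
      | add a _ b _ ha hb =>
        intro d hd
        rcases Finset.mem_union.mp (support_add hd) with h | h
        exacts [ha d h, hb d h]
  · rw [p.as_sum]
    exact sum_mem fun d hd => monomial_mem_pow_span_X_image _ (hp d hd)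

theorem monomial_mul_mem_pow_span_X_image_iff {T : Finset σ} {n : ℕ} {u : σ →₀ ℕ}
    {p : MvPolynomial σ R} :
    monomial u 1 * p ∈
        Ideal.span (X '' (T : Set σ) : Set (MvPolynomial σ R)) ^ (n + ∑ j ∈ T, u j) ↔
      p ∈ Ideal.span (X '' (T : Set σ) : Set (MvPolynomial σ R)) ^ n := by
  simp only [mem_pow_span_X_image_iff, mem_support_iff]
  refine ⟨fun h d hd => ?_, fun h d hd => ?_⟩
  · have := h (u + d) (by rwa [coeff_monomial_mul, one_mul])
    simp only [Finsupp.add_apply, Finset.sum_add_distrib] at this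
    omega
  · rw [coeff_monomial_mul'] at hd
    split_ifs at hd with hu
    · obtain ⟨e, rfl⟩ := exists_add_of_le hu
      have := h e (by simpa using hd)
      simp only [Finsupp.add_apply, Finset.sum_add_distrib]
      omega
    · exact absurd rfl hd

end MvPolynomial

/-- Let `k` be a field and `R = k[x_1,…,x_m]`.  If `s ≥ m ≥ 2`, then
`I(K_m)^{(s)} ∩ ⟨x_1⋯x_m⟩ = x_1⋯x_m · I(K_m)^{(s−m+1)}`, where
`I(K_m)^{(t)} = ⋂_i P_i^t` with `P_i = ⟨x_j : j ≠ i⟩`. -/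
theorem symbolicPower_inter_product_of_variables {k : Type*} [Field k] {m : ℕ}
    (hm : 2 ≤ m) (s : ℕ) (hsm : m ≤ s) :
    (⨅ i : Fin m,
        (Ideal.span {p : MvPolynomial (Fin m) k | ∃ j : Fin m, j ≠ i ∧ p = X j}) ^ s) ⊓
      Ideal.span {∏ i : Fin m, (X i : MvPolynomial (Fin m) k)} =
    Ideal.span {∏ i : Fin m, (X i : MvPolynomial (Fin m) k)} *
      (⨅ i : Fin m,
        (Ideal.span {p : MvPolynomial (Fin m) k | ∃ j : Fin m, j ≠ i ∧ p = X j}) ^ (s - m + 1)) := by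
  have hspan (i : Fin m) : {p : MvPolynomial (Fin m) k | ∃ j : Fin m, j ≠ i ∧ p = X j} =
      X '' ((univ.erase i : Finset (Fin m)) : Set (Fin m)) := by
    ext p
    simp [eq_comm]
  have hprod : ∏ i : Fin m, (X i : MvPolynomial (Fin m) k) =
      monomial (Finsupp.equivFunOnFinite.symm 1) 1 := by
    simp [monomial_eq, Finsupp.prod_fintype]
  have key (i : Fin m) (p : MvPolynomial (Fin m) k) :
      (∏ i : Fin m, X i) * p ∈
          Ideal.span {p : MvPolynomial (Fin m) k | ∃ j : Fin m, j ≠ i ∧ p = X j} ^ s ↔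
        p ∈ Ideal.span {p : MvPolynomial (Fin m) k | ∃ j : Fin m, j ≠ i ∧ p = X j} ^
          (s - m + 1) := by
    rw [hspan, hprod, ← monomial_mul_mem_pow_span_X_image_iff (n := s - m + 1)
      (u := Finsupp.equivFunOnFinite.symm 1)]
    have hs : s - m + 1 + ∑ j ∈ univ.erase i,
        (Finsupp.equivFunOnFinite.symm (1 : Fin m → ℕ)) j = s := by
      simp
      omega
    rw [hs]
  ext p
  rw [Submodule.mem_inf, Ideal.mem_span_singleton, Ideal.mem_span_singleton_mul]
  constructor
  · rintro ⟨hp, q, rfl⟩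
    exact ⟨q, (Submodule.mem_iInf _).mpr fun i => (key i q).mp ((Submodule.mem_iInf _).mp hp i), rfl⟩
  · rintro ⟨q, hq, rfl⟩
    exact ⟨(Submodule.mem_iInf _).mpr fun i => (key i q).mpr ((Submodule.mem_iInf _).mp hq i),
      dvd_mul_right _ _⟩
end
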